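/- For P(x,y) = x^{2i+1} y^{2j+1}/((2i+1)!(2j+1)!), the Laplace transform of the D-kernel transform equals the even principal part: L{∫₀^∞∫₀^∞ D(L,x,y) P(x,y) dx dy}(z) = Σ_{m=0}^{i+j+1} z^{−(2m+2)} · a_{i+j+1−m}/((2i+2j+2−2m)!), which is the principal part at z = 0 of (1/cos(2πz)) · z^{−(2i+2)} z^{−(2j+2)}, where the a_n are defined by 1/cos(2πz) = Σ a_n z^{2n}/(2n)!. -/

import Mathlib

open Real MeasureTheory

/-- The kernel `H(x,y) = (1/(4π))(1/cosh((x−y)/4) − 1/cosh((x+y)/4))`. -/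
noncomputable def Hker (x y : ℝ) : ℝ :=
  (1 / (4 * Real.pi)) *
    (1 / Real.cosh ((x - y) / 4) - 1 / Real.cosh ((x + y) / 4))

/-- The kernel `D(L,x,y) = H(L, x+y)`. -/
noncomputable def Dker (x y z : ℝ) : ℝ := Hker x (y + z)

/-- The Taylor coefficients `a_n` of `1/cos(2πz) = Σ a_n z^{2n}/(2n)!`. -/
noncomputable def secCoeff (n : ℕ) : ℝ :=
  iteratedDeriv (2 * n) (fun x : ℝ => (Real.cos (2 * Real.pi * x))⁻¹) 0

/-- The real Beta integral, with its convergence. -/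
lemma integral_rpow_mul_one_sub_rpow {a b : ℝ} (ha : 0 < a) (hb : 0 < b) :
    IntegrableOn (fun x : ℝ => x ^ (a - 1) * (1 - x) ^ (b - 1)) (Set.Ioo 0 1) ∧
      ∫ x in Set.Ioo (0 : ℝ) 1, x ^ (a - 1) * (1 - x) ^ (b - 1) = ProbabilityTheory.beta a b := by
  have hB := ProbabilityTheory.beta_pos ha hb
  have h1 := ProbabilityTheory.lintegral_betaPDF_eq_one ha hb
  rw [ProbabilityTheory.lintegral_betaPDF] at h1
  simp_rw [mul_assoc] at h1
  have hnn : 0 ≤ᵐ[volume.restrict (Set.Ioo (0 : ℝ) 1)]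
      fun x : ℝ => 1 / ProbabilityTheory.beta a b * (x ^ (a - 1) * (1 - x) ^ (b - 1)) := by
    refine ae_restrict_of_forall_mem measurableSet_Ioo fun x hx => ?_
    have h2 := Real.rpow_nonneg hx.1.le (a - 1)
    have h3 := Real.rpow_nonneg (sub_nonneg.2 hx.2.le) (b - 1)
    simp only [Pi.zero_apply]
    positivity
  have hm : AEStronglyMeasurable
      (fun x : ℝ => 1 / ProbabilityTheory.beta a b * (x ^ (a - 1) * (1 - x) ^ (b - 1)))
      (volume.restrict (Set.Ioo (0 : ℝ) 1)) :=
    Measurable.aestronglyMeasurable (by fun_prop)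
  constructor
  · have h4 := (lintegral_ofReal_ne_top_iff_integrable hm hnn).1 (by rw [h1]; simp)
    exact (integrable_const_mul_iff (by simp [hB.ne']) _).1 h4
  · have h5 := integral_eq_lintegral_of_nonneg_ae hnn hm
    rw [h1, integral_const_mul, ENNReal.toReal_one] at h5
    field_simp at h5
    exact h5

lemma sigmoid_rpow_mul_eq {w : ℝ} (v : ℝ) :
    |sigmoid v * (1 - sigmoid v)| • (sigmoid v ^ ((1 / 2 + 2 * w) - 1) *
      (1 - sigmoid v) ^ ((1 / 2 - 2 * w) - 1)) =
      2⁻¹ * (exp (w * (2 * v)) / cosh ((2 * v) / 4)) := by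
  have hs := sigmoid_pos v
  have hs' : 0 < 1 - sigmoid v := sub_pos.2 (sigmoid_lt_one v)
  rw [abs_of_pos (mul_pos hs hs'), Real.rpow_sub_one hs.ne', Real.rpow_sub_one hs'.ne', smul_eq_mul]
  have e1 : 1 - sigmoid v = exp (-v) * sigmoid v := by
    rw [← sigmoid_neg, ← sigmoid_mul_rexp_neg, mul_comm]
  have e2 : sigmoid v ^ (1 / 2 + 2 * w) * (1 - sigmoid v) ^ (1 / 2 - 2 * w) =
      exp (-v * (1 / 2 - 2 * w)) * sigmoid v := by
    rw [e1, Real.mul_rpow (exp_pos _).le hs.le, ← Real.exp_mul, mul_left_comm, ← Real.rpow_add hs]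
    norm_num
  have e3 : sigmoid v * (1 - sigmoid v) * (sigmoid v ^ (1 / 2 + 2 * w) / sigmoid v *
      ((1 - sigmoid v) ^ (1 / 2 - 2 * w) / (1 - sigmoid v))) =
      sigmoid v ^ (1 / 2 + 2 * w) * (1 - sigmoid v) ^ (1 / 2 - 2 * w) := by
    field_simp
  rw [e3, e2, sigmoid_def, Real.cosh_eq]
  have e4 : exp (w * (2 * v)) = exp (-v * (1 / 2 - 2 * w)) * exp (2 * v / 4) := by
    rw [← Real.exp_add]; ring_nf
  have e5 : exp (-(2 * v / 4)) = exp (2 * v / 4) * exp (-v) := by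
    rw [← Real.exp_add]; ring_nf
  rw [e4, e5]
  have := exp_pos (2 * v / 4)
  have := exp_pos (-v)
  field_simp

/-- The two-sided Laplace transform of the hyperbolic secant. -/
lemma integral_exp_mul_div_cosh {w : ℝ} (hw : |w| < 1 / 4) :
    Integrable (fun u : ℝ => exp (w * u) / cosh (u / 4)) ∧
      ∫ u : ℝ, exp (w * u) / cosh (u / 4) = 4 * π * (cos (2 * π * w))⁻¹ := by
  obtain ⟨hw1, hw2⟩ := abs_lt.1 hw
  have ha : 0 < 1 / 2 + 2 * w := by linarith
  have hb : 0 < 1 / 2 - 2 * w := by linarith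
  obtain ⟨hi, he⟩ := integral_rpow_mul_one_sub_rpow ha hb
  have hd : ∀ x ∈ Set.univ, HasDerivWithinAt sigmoid (sigmoid x * (1 - sigmoid x)) Set.univ x :=
    fun x _ => (hasDerivAt_sigmoid x).hasDerivWithinAt
  rw [← range_sigmoid, ← Set.image_univ] at hi he
  rw [integrableOn_image_iff_integrableOn_abs_deriv_smul MeasurableSet.univ hd
    sigmoid_injective.injOn] at hi
  rw [integral_image_eq_integral_abs_deriv_smul MeasurableSet.univ hd
    sigmoid_injective.injOn] at he
  simp_rw [sigmoid_rpow_mul_eq] at hi he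
  rw [integrableOn_univ, integrable_const_mul_iff (by simp)] at hi
  rw [Measure.restrict_univ, integral_const_mul,
    Measure.integral_comp_mul_left (fun u : ℝ => exp (w * u) / cosh (u / 4)) 2] at he
  refine ⟨(integrable_comp_mul_left_iff _ (two_ne_zero)).1 hi, ?_⟩
  have hb1 : ProbabilityTheory.beta (1 / 2 + 2 * w) (1 / 2 - 2 * w) =
      π * (cos (2 * π * w))⁻¹ := by
    rw [ProbabilityTheory.beta]
    have h1 : (1 / 2 - 2 * w) = 1 - (1 / 2 + 2 * w) := by ring
    rw [h1, Real.Gamma_mul_Gamma_one_sub]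
    have h2 : π * (1 / 2 + 2 * w) = 2 * π * w + π / 2 := by ring
    rw [h2, Real.sin_add_pi_div_two]
    simp [div_eq_mul_inv]
  rw [hb1] at he
  norm_num [abs_of_pos] at he
  linarith

/-- The probability measure with density `sech(u/4)/(4π)`. -/
noncomputable def sechMeasure : Measure ℝ :=
  volume.withDensity fun u => ENNReal.ofReal ((4 * π)⁻¹ * (cosh (u / 4))⁻¹)

lemma sechDensity_nonneg (u : ℝ) : 0 ≤ (4 * π)⁻¹ * (cosh (u / 4))⁻¹ := by
  have := cosh_pos (u / 4)
  positivity

lemma measurable_sechDensity :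
    Measurable fun u : ℝ => ENNReal.ofReal ((4 * π)⁻¹ * (cosh (u / 4))⁻¹) := by
  have : Measurable fun u : ℝ => cosh (u / 4) := by fun_prop
  fun_prop

lemma integrable_sechMeasure_iff (f : ℝ → ℝ) :
    Integrable f sechMeasure ↔ Integrable fun u => f u / cosh (u / 4) := by
  rw [sechMeasure, integrable_withDensity_iff_integrable_smul' measurable_sechDensity
    (by simp)]
  simp_rw [ENNReal.toReal_ofReal (sechDensity_nonneg _), smul_eq_mul, mul_assoc]
  rw [integrable_const_mul_iff (by simp [pi_ne_zero])]
  simp_rw [div_eq_inv_mul]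

lemma integral_sechMeasure (f : ℝ → ℝ) :
    ∫ u, f u ∂sechMeasure = (4 * π)⁻¹ * ∫ u, f u / cosh (u / 4) := by
  rw [sechMeasure, integral_withDensity_eq_integral_toReal_smul measurable_sechDensity
    (by simp)]
  simp_rw [ENNReal.toReal_ofReal (sechDensity_nonneg _), smul_eq_mul, mul_assoc]
  rw [integral_const_mul]
  simp_rw [div_eq_inv_mul]

lemma Ioo_subset_integrableExpSet_sechMeasure :
    Set.Ioo (-(1 / 4)) (1 / 4) ⊆ ProbabilityTheory.integrableExpSet id sechMeasure := by
  intro w hw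
  exact (integrable_sechMeasure_iff _).2 (integral_exp_mul_div_cosh (abs_lt.2 hw)).1

lemma zero_mem_interior_integrableExpSet_sechMeasure :
    0 ∈ interior (ProbabilityTheory.integrableExpSet id sechMeasure) :=
  interior_mono Ioo_subset_integrableExpSet_sechMeasure (by
    rw [interior_Ioo]; norm_num)

lemma integrable_pow_div_cosh (n : ℕ) : Integrable fun u : ℝ => u ^ n / cosh (u / 4) :=
  (integrable_sechMeasure_iff _).1
    (ProbabilityTheory.integrable_pow_of_mem_interior_integrableExpSet
      zero_mem_interior_integrableExpSet_sechMeasure n)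

lemma integral_pow_even_div_cosh (n : ℕ) :
    (4 * π)⁻¹ * ∫ u : ℝ, u ^ (2 * n) / cosh (u / 4) = secCoeff n := by
  rw [← integral_sechMeasure, secCoeff]
  have h := ProbabilityTheory.iteratedDeriv_mgf_zero
    zero_mem_interior_integrableExpSet_sechMeasure (2 * n)
  have hE : (fun x : ℝ => (cos (2 * π * x))⁻¹) =ᶠ[nhds 0]
      ProbabilityTheory.mgf id sechMeasure := by
    filter_upwards [Ioo_mem_nhds (show -(1 / 4 : ℝ) < 0 by norm_num)
      (show (0 : ℝ) < 1 / 4 by norm_num)] with w hw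
    rw [ProbabilityTheory.mgf, integral_sechMeasure]
    simp only [id]
    rw [(integral_exp_mul_div_cosh (abs_lt.2 hw)).2]
    field_simp
  rw [hE.iteratedDeriv_eq, h]
  simp

lemma integral_pow_odd_div_cosh {n : ℕ} (hn : Odd n) :
    ∫ u : ℝ, u ^ n / cosh (u / 4) = 0 := by
  have h := integral_neg_eq_self (fun u : ℝ => u ^ n / cosh (u / 4)) volume
  simp only [hn.neg_pow, neg_div, cosh_neg, integral_neg] at h
  linarith

lemma add_pow_div_cosh (n : ℕ) (L u : ℝ) :
    (L + u) ^ n / cosh (u / 4) =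
      ∑ m ∈ Finset.range (n + 1), L ^ m * (n.choose m) * (u ^ (n - m) / cosh (u / 4)) := by
  rw [add_pow, Finset.sum_div]
  exact Finset.sum_congr rfl fun m _ => by ring

lemma integrable_pow_div_cosh_sub (n : ℕ) (L : ℝ) :
    Integrable fun s : ℝ => s ^ n / cosh ((L - s) / 4) := by
  have h : Integrable fun u : ℝ => (L + u) ^ n / cosh (u / 4) := by
    simp_rw [add_pow_div_cosh]
    exact integrable_finsetSum _ fun m _ => (integrable_pow_div_cosh _).const_mul _
  convert h.comp_sub_right L using 2 with s
  rw [← cosh_neg]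
  ring_nf

lemma sum_range_two_mul (f : ℕ → ℝ) (n : ℕ) :
    ∑ i ∈ Finset.range (2 * n), f i = ∑ i ∈ Finset.range n, (f (2 * i) + f (2 * i + 1)) := by
  induction n with
  | zero => simp
  | succ n ih => rw [Nat.mul_succ, Finset.sum_range_succ, Finset.sum_range_succ, ih,
      Finset.sum_range_succ, add_assoc]

lemma integral_pow_odd_div_cosh_sub (k : ℕ) (L : ℝ) :
    (4 * π)⁻¹ * ∫ s : ℝ, s ^ (2 * k + 1) / cosh ((L - s) / 4) =
      ∑ m ∈ Finset.range (k + 1),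
        L ^ (2 * m + 1) * ((2 * k + 1).choose (2 * m + 1)) * secCoeff (k - m) := by
  have h : ∫ s : ℝ, s ^ (2 * k + 1) / cosh ((L - s) / 4) =
      ∫ u : ℝ, (L + u) ^ (2 * k + 1) / cosh (u / 4) := by
    rw [← integral_sub_right_eq_self (fun u : ℝ => (L + u) ^ (2 * k + 1) / cosh (u / 4)) L]
    congr 1 with s
    rw [← cosh_neg]
    ring_nf
  simp_rw [h, add_pow_div_cosh]
  rw [integral_finsetSum _ fun m _ => (integrable_pow_div_cosh _).const_mul _]
  simp_rw [integral_const_mul]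
  rw [show 2 * k + 1 + 1 = 2 * (k + 1) by ring, sum_range_two_mul, Finset.mul_sum]
  refine Finset.sum_congr rfl fun m hm => ?_
  have hm' : m ≤ k := Nat.lt_succ_iff.1 (Finset.mem_range.1 hm)
  rw [show 2 * k + 1 - (2 * m + 1) = 2 * (k - m) by omega,
    integral_pow_odd_div_cosh (n := 2 * k + 1 - 2 * m) ⟨k - m, by omega⟩,
    ← integral_pow_even_div_cosh]
  ring

lemma pow_mul_Hker (k : ℕ) (L s : ℝ) :
    s ^ (2 * k + 1) * Hker L s = (4 * π)⁻¹ * (s ^ (2 * k + 1) / cosh ((L - s) / 4) +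
      (-s) ^ (2 * k + 1) / cosh ((L - (-s)) / 4)) := by
  rw [Hker, Odd.neg_pow ⟨k, rfl⟩, sub_neg_eq_add]
  ring

lemma integrableOn_pow_mul_Hker (k : ℕ) (L : ℝ) :
    IntegrableOn (fun s => s ^ (2 * k + 1) * Hker L s) (Set.Ioi 0) := by
  simp_rw [pow_mul_Hker]
  have h := integrable_pow_div_cosh_sub (2 * k + 1) L
  exact ((h.add h.comp_neg).const_mul _).integrableOn

lemma integral_pow_mul_Hker (k : ℕ) (L : ℝ) :
    ∫ s in Set.Ioi (0 : ℝ), s ^ (2 * k + 1) * Hker L s =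
      ∑ m ∈ Finset.range (k + 1),
        L ^ (2 * m + 1) * ((2 * k + 1).choose (2 * m + 1)) * secCoeff (k - m) := by
  have h := integrable_pow_div_cosh_sub (2 * k + 1) L
  simp_rw [pow_mul_Hker]
  rw [integral_const_mul, integral_add h.integrableOn h.comp_neg.integrableOn,
    integral_comp_neg_Ioi 0 (fun s : ℝ => s ^ (2 * k + 1) / cosh ((L - s) / 4)), neg_zero,
    add_comm, intervalIntegral.integral_Iic_add_Ioi h.integrableOn h.integrableOn,
    integral_pow_odd_div_cosh_sub]

lemma integral_pow_mul_sub_pow (a b : ℕ) {s : ℝ} (hs : 0 < s) :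
    ∫ x in Set.Ioo 0 s, x ^ a * (s - x) ^ b =
      (a.factorial * b.factorial / (a + b + 1).factorial : ℝ) * s ^ (a + b + 1) := by
  rw [← integral_Ioc_eq_integral_Ioo, ← intervalIntegral.integral_of_le hs.le]
  have h1 := intervalIntegral.smul_integral_comp_mul_left
    (fun x : ℝ => x ^ a * (s - x) ^ b) s (a := 0) (b := 1)
  have h2 : ∀ x : ℝ, (s * x) ^ a * (s - s * x) ^ b = s ^ (a + b) * (x ^ a * (1 - x) ^ b) := by
    intro x
    rw [show s - s * x = s * (1 - x) by ring, mul_pow, mul_pow, pow_add]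
    ring
  have h3 := (integral_rpow_mul_one_sub_rpow (a := a + 1) (b := b + 1) (by positivity)
    (by positivity)).2
  simp only [add_sub_cancel_right, rpow_natCast] at h3
  simp only [h2, mul_zero, mul_one] at h1
  rw [← h1, intervalIntegral.integral_const_mul, intervalIntegral.integral_of_le zero_le_one,
    integral_Ioc_eq_integral_Ioo, h3, ProbabilityTheory.beta, Gamma_nat_eq_factorial,
    Gamma_nat_eq_factorial, show (a + 1 + (b + 1) : ℝ) = ((a + b + 1 : ℕ) : ℝ) + 1 by
      push_cast; ring, Gamma_nat_eq_factorial, smul_eq_mul]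
  ring

/-- Integrating a function of `x + y` against a monomial over the quadrant. -/
lemma integral_integral_comp_add_mul_pow (a b : ℕ) {g : ℝ → ℝ} (hg : Measurable g)
    (hi : IntegrableOn (fun s => s ^ (a + b + 1) * g s) (Set.Ioi 0)) :
    ∫ x in Set.Ioi (0 : ℝ), ∫ y in Set.Ioi (0 : ℝ), g (x + y) * (x ^ a * y ^ b) =
      (a.factorial * b.factorial / (a + b + 1).factorial : ℝ) *
        ∫ s in Set.Ioi (0 : ℝ), s ^ (a + b + 1) * g s := by
  set c : ℝ := (a.factorial * b.factorial / (a + b + 1).factorial : ℝ)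
  let T : Set (ℝ × ℝ) := {p | 0 < p.1 ∧ p.1 < p.2}
  have hT : MeasurableSet T :=
    (measurableSet_lt measurable_const measurable_fst).inter
      (measurableSet_lt measurable_fst measurable_snd)
  let f : ℝ → ℝ → ℝ := fun x s =>
    T.indicator (fun p : ℝ × ℝ => g p.2 * (p.1 ^ a * (p.2 - p.1) ^ b)) (x, s)
  have hfm : Measurable (Function.uncurry f) := by
    refine Measurable.indicator ?_ hT
    fun_prop
  have hsec : ∀ s : ℝ, (fun x => f x s) =
      (Set.Ioo 0 s).indicator fun x => g s * (x ^ a * (s - x) ^ b) := by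
    intro s
    ext x
    simp only [f, T, Set.indicator, Set.mem_ofPred_eq, Set.mem_Ioo]
  have hint : ∀ h : ℝ → ℝ, ∀ s : ℝ,
      ∫ x, (Set.Ioo 0 s).indicator (fun x => h s * (x ^ a * (s - x) ^ b)) x =
        (Set.Ioi 0).indicator (fun s => c * (s ^ (a + b + 1) * h s)) s := by
    intro h s
    rw [integral_indicator measurableSet_Ioo, integral_const_mul]
    by_cases hs : 0 < s
    · rw [integral_pow_mul_sub_pow a b hs, Set.indicator_of_mem (Set.mem_Ioi.2 hs)]
      ring
    · rw [Set.Ioo_eq_empty hs, Set.indicator_of_notMem (by simpa using hs)]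
      simp
  have hF : Integrable (Function.uncurry f) (volume.prod volume) := by
    refine (integrable_prod_iff' hfm.aestronglyMeasurable).2 ⟨.of_forall fun s => ?_, ?_⟩
    · simp only [Function.uncurry_apply_pair]
      rw [hsec, integrable_indicator_iff measurableSet_Ioo]
      exact (Continuous.integrableOn_Icc (by fun_prop)).mono_set Set.Ioo_subset_Icc_self
    · have h1 : ∀ s x : ℝ, ‖f x s‖ =
          (Set.Ioo 0 s).indicator (fun x => |g s| * (x ^ a * (s - x) ^ b)) x := by
        intro s x
        rw [show f x s = _ from congrFun (hsec s) x]
        by_cases hx : x ∈ Set.Ioo 0 s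
        · rw [Set.indicator_of_mem hx, Set.indicator_of_mem hx, norm_mul, norm_eq_abs,
            norm_of_nonneg (mul_nonneg (pow_nonneg hx.1.le _)
              (pow_nonneg (sub_nonneg.2 hx.2.le) _))]
        · rw [Set.indicator_of_notMem hx, Set.indicator_of_notMem hx, norm_zero]
      simp only [Function.uncurry_apply_pair, h1]
      simp_rw [hint fun s => |g s|]
      rw [integrable_indicator_iff measurableSet_Ioi]
      refine Integrable.const_mul (hi.norm.congr ?_) c
      refine ae_restrict_of_forall_mem measurableSet_Ioi fun s hs => ?_
      simp only [norm_mul, norm_eq_abs, abs_of_pos (pow_pos (Set.mem_Ioi.1 hs) _)]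
  have hL : ∫ x in Set.Ioi (0 : ℝ), ∫ y in Set.Ioi (0 : ℝ), g (x + y) * (x ^ a * y ^ b) =
      ∫ x, ∫ s, f x s := by
    rw [← integral_indicator measurableSet_Ioi]
    congr 1 with x
    by_cases hx : 0 < x
    · rw [Set.indicator_of_mem (Set.mem_Ioi.2 hx), ← integral_indicator measurableSet_Ioi,
        ← integral_add_left_eq_self (f x) x]
      congr 1 with y
      simp [f, T, Set.indicator, hx]
    · rw [Set.indicator_of_notMem (by simpa using hx)]
      simp [f, T, Set.indicator, hx]
  rw [hL, integral_integral_swap hF]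
  simp_rw [hsec, hint g]
  rw [integral_indicator measurableSet_Ioi, integral_const_mul]

lemma integral_exp_neg_mul_pow (n : ℕ) {z : ℝ} (hz : 0 < z) :
    ∫ L in Set.Ioi (0 : ℝ), exp (-(z * L)) * L ^ n = n.factorial * (z ^ (n + 1))⁻¹ := by
  have h := integral_rpow_mul_exp_neg_mul_Ioi (a := n + 1) (by positivity) hz
  simp only [add_sub_cancel_right, rpow_natCast, Gamma_nat_eq_factorial] at h
  simp_rw [mul_comm (exp _), h]
  rw [mul_comm, one_div, inv_rpow hz.le]
  norm_cast

lemma integrableOn_exp_neg_mul_pow (n : ℕ) {z : ℝ} (hz : 0 < z) :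
    IntegrableOn (fun L => exp (-(z * L)) * L ^ n) (Set.Ioi 0) := by
  refine Integrable.of_integral_ne_zero ?_
  rw [integral_exp_neg_mul_pow n hz]
  positivity

lemma measurable_Hker (L : ℝ) : Measurable (Hker L) := by
  have h1 : Measurable fun s : ℝ => cosh ((L - s) / 4) := by fun_prop
  have h2 : Measurable fun s : ℝ => cosh ((L + s) / 4) := by fun_prop
  exact ((h1.const_div 1).sub (h2.const_div 1)).const_mul _

/-- The `D`-kernel transform of a normalized odd monomial is an odd polynomial in `L`. -/
lemma integral_integral_Dker_mul_pow (i j : ℕ) (L : ℝ) :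
    ∫ x in Set.Ioi (0 : ℝ), ∫ y in Set.Ioi (0 : ℝ),
      Dker L x y * (x ^ (2 * i + 1) * y ^ (2 * j + 1) /
        ((Nat.factorial (2 * i + 1) : ℝ) * (Nat.factorial (2 * j + 1) : ℝ))) =
    ∑ m ∈ Finset.range (i + j + 2), secCoeff (i + j + 1 - m) /
      ((2 * m + 1).factorial * (2 * i + 2 * j + 2 - 2 * m).factorial : ℝ) * L ^ (2 * m + 1) := by
  simp_rw [← mul_div_assoc, integral_div, Dker]
  have he : 2 * i + 1 + (2 * j + 1) + 1 = 2 * (i + j + 1) + 1 := by ring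
  rw [integral_integral_comp_add_mul_pow _ _ (measurable_Hker L)
    (by rw [he]; exact integrableOn_pow_mul_Hker _ _), he, integral_pow_mul_Hker,
    Finset.mul_sum, Finset.sum_div]
  refine Finset.sum_congr rfl fun m hm => ?_
  have hm' : m < i + j + 2 := Finset.mem_range.1 hm
  rw [Nat.cast_choose ℝ (show 2 * m + 1 ≤ 2 * (i + j + 1) + 1 by omega),
    show 2 * (i + j + 1) + 1 - (2 * m + 1) = 2 * i + 2 * j + 2 - 2 * m by omega]
  have h1 := Nat.factorial_ne_zero (2 * i + 1)
  have h2 := Nat.factorial_ne_zero (2 * j + 1)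
  have h3 := Nat.factorial_ne_zero (2 * (i + j + 1) + 1)
  field_simp

/-- For `P(x,y) = x^{2i+1} y^{2j+1}/((2i+1)!(2j+1)!)`, the Laplace transform of
the `D`-kernel transform equals
`Σ_{m=0}^{i+j+1} z^{−(2m+2)} a_{i+j+1−m}/((2i+2j+2−2m)!)`, which is the
(even) principal part at `z = 0` of `(1/cos(2πz)) z^{−(2i+2)} z^{−(2j+2)}`. -/
theorem stmt16 (i j : ℕ) (z : ℝ) (hz : 0 < z) :
    (∫ L in Set.Ioi (0 : ℝ), Real.exp (-(z * L)) *
        ∫ x in Set.Ioi (0 : ℝ), ∫ y in Set.Ioi (0 : ℝ),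
          Dker L x y * (x ^ (2 * i + 1) * y ^ (2 * j + 1) /
            ((Nat.factorial (2 * i + 1) : ℝ) * (Nat.factorial (2 * j + 1) : ℝ)))) =
      ∑ m ∈ Finset.range (i + j + 2),
        (z ^ (2 * m + 2))⁻¹ *
          (secCoeff (i + j + 1 - m) /
            (Nat.factorial (2 * i + 2 * j + 2 - 2 * m) : ℝ)) := by
  simp_rw [integral_integral_Dker_mul_pow, Finset.mul_sum, mul_left_comm (exp _)]
  rw [integral_finsetSum _ fun m _ => (integrableOn_exp_neg_mul_pow _ hz).const_mul _]
  refine Finset.sum_congr rfl fun m _ => ?_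
  rw [integral_const_mul, integral_exp_neg_mul_pow _ hz]
  have h := Nat.factorial_ne_zero (2 * m + 1)
  field_simp
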